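/- Let b > 1/2. There exists a constant C > 0 depending only on b such that for every ξ₃ ∈ ℝ with ξ₃ ≠ 0 and every τ₃ ∈ ℝ, ∫_{A} (1 + |P(ξ₁)|)^{−2b} dξ₁ ≤ C·ξ₃^{−2}, where A := {ξ₁ ∈ ℝ : min(|ξ₁|, |ξ₁ + ξ₃|) < |ξ₃|/8} and P(ξ₁) := 3·ξ₁³ + 12·ξ₃·ξ₁² + 12·ξ₃²·ξ₁ + 4·ξ₃³ − τ₃. -/

import Mathlib

open MeasureTheory Real

/-- If `f` is injective on `s` with `c ≤ |f'|` there, then the integral of `g ∘ f` over `s` is at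
most `c⁻¹` times the integral of the nonnegative function `g`. -/
theorem setIntegral_comp_le_of_le_abs_deriv {s : Set ℝ} {f f' g : ℝ → ℝ} {c : ℝ}
    (hs : MeasurableSet s) (hf' : ∀ x ∈ s, HasDerivAt f (f' x) x) (hf : Set.InjOn f s)
    (hc : 0 < c) (hcf : ∀ x ∈ s, c ≤ |f' x|) (hg : Integrable g) (hg0 : ∀ y, 0 ≤ g y)
    (hgf : AEStronglyMeasurable (fun x => g (f x)) (volume.restrict s)) :
    IntegrableOn (fun x => g (f x)) s ∧ ∫ x in s, g (f x) ≤ (∫ y, g y) / c := by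
  have hd : ∀ x ∈ s, HasDerivWithinAt f (f' x) s x := fun x hx => (hf' x hx).hasDerivWithinAt
  have hint : IntegrableOn (fun x => |f' x| * g (f x)) s :=
    (integrableOn_image_iff_integrableOn_abs_deriv_smul hs hd hf g).1 hg.integrableOn
  have hle : ∀ x ∈ s, g (f x) ≤ |f' x| * g (f x) / c := fun x hx => by
    rw [le_div_iff₀ hc, mul_comm]
    exact mul_le_mul_of_nonneg_right (hcf x hx) (hg0 _)
  have hcomp : IntegrableOn (fun x => g (f x)) s := by
    refine (hint.div_const c).mono' hgf ?_
    filter_upwards [ae_restrict_mem hs] with x hx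
    rw [Real.norm_of_nonneg (hg0 _)]
    exact hle x hx
  refine ⟨hcomp, ?_⟩
  calc ∫ x in s, g (f x) ≤ ∫ x in s, |f' x| * g (f x) / c :=
        setIntegral_mono_on hcomp (hint.div_const c) hs hle
    _ = (∫ y in f '' s, g y) / c := by
        rw [integral_div, integral_image_eq_integral_abs_deriv_smul hs hd hf g]
        simp only [smul_eq_mul]
    _ ≤ (∫ y, g y) / c := by
        gcongr
        · exact .of_forall hg0
        · exact Measure.restrict_le_self

theorem abs_mul_le_and_sq_le_of_abs_lt {u z : ℝ} (h : |u| < |z| / 8) :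
    |z * u| ≤ z ^ 2 / 8 ∧ u ^ 2 ≤ z ^ 2 / 64 := by
  have hz := sq_abs z
  have hu := sq_abs u
  rw [abs_mul]
  constructor <;> nlinarith [abs_nonneg u, abs_nonneg z]

/-- The key calculus estimate in Case 3 of the bilinear estimate: for `b > 1/2` there is
`C = C(b) > 0` with `∫_A (1+|P(ξ₁)|)^{-2b} dξ₁ ≤ C/ξ₃²`, where
`A = {ξ₁ : min(|ξ₁|,|ξ₁+ξ₃|) < |ξ₃|/8}` and
`P(ξ₁) = 3ξ₁³ + 12ξ₃ξ₁² + 12ξ₃²ξ₁ + 4ξ₃³ − τ₃`. -/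
theorem resonance_integral_bound (b : ℝ) (hb : 1 / 2 < b) :
    ∃ C : ℝ, 0 < C ∧
      ∀ ξ₃ : ℝ, ξ₃ ≠ 0 → ∀ τ₃ : ℝ,
        (∫ ξ₁ in {ξ₁ : ℝ | min |ξ₁| |ξ₁ + ξ₃| < |ξ₃| / 8},
            (1 + |3 * ξ₁ ^ 3 + 12 * ξ₃ * ξ₁ ^ 2 + 12 * ξ₃ ^ 2 * ξ₁ + 4 * ξ₃ ^ 3 - τ₃|) ^
              (-(2 * b))) ≤ C / ξ₃ ^ 2 := by
  have hg : Integrable (fun y : ℝ => (1 + |y|) ^ (-(2 * b))) := by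
    simpa using integrable_one_add_norm (E := ℝ) (μ := volume) (r := 2 * b)
      (by simp; linarith)
  have hg0 : ∀ y : ℝ, 0 ≤ (1 + |y|) ^ (-(2 * b)) := fun y => by positivity
  have hI : 0 ≤ ∫ y : ℝ, (1 + |y|) ^ (-(2 * b)) := integral_nonneg hg0
  refine ⟨2 * (∫ y : ℝ, (1 + |y|) ^ (-(2 * b))) + 1, by linarith, fun z hz τ => ?_⟩
  have hz2 : 0 < z ^ 2 := by positivity
  set P : ℝ → ℝ := fun x => 3 * x ^ 3 + 12 * z * x ^ 2 + 12 * z ^ 2 * x + 4 * z ^ 3 - τ with hP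
  have hPd : ∀ x, HasDerivAt P (9 * x ^ 2 + 24 * z * x + 12 * z ^ 2) x := fun x => by
    have h := ((((hasDerivAt_pow 3 x).const_mul 3).add
      ((hasDerivAt_pow 2 x).const_mul (12 * z))).add
      ((hasDerivAt_id x).const_mul (12 * z ^ 2))).add_const (4 * z ^ 3 - τ)
    refine (h.congr_deriv (by norm_num; ring)).congr_of_eventuallyEq (.of_forall fun y => ?_)
    simp [hP]; ring
  have hPsub : ∀ x y, P x - P y =
      (x - y) * (3 * (x ^ 2 + x * y + y ^ 2) + 12 * z * (x + y) + 12 * z ^ 2) := fun x y => by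
    simp only [hP]; ring
  have hinj : ∀ s : Set ℝ, (∀ x ∈ s, ∀ y ∈ s,
      3 * (x ^ 2 + x * y + y ^ 2) + 12 * z * (x + y) + 12 * z ^ 2 ≠ 0) → Set.InjOn P s := by
    intro s h x hx y hy hxy
    have := hPsub x y
    rw [hxy, sub_self, eq_comm, mul_eq_zero] at this
    exact sub_eq_zero.1 (this.resolve_right (h x hx y hy))
  have hmeas : Measurable (fun x => (1 + |P x|) ^ (-(2 * b))) := by fun_prop
  set S : Set ℝ := {x | |x| < |z| / 8}
  set T : Set ℝ := {x | |x + z| < |z| / 8}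
  have hS : MeasurableSet S := measurableSet_lt (by fun_prop) (by fun_prop)
  have hT : MeasurableSet T := measurableSet_lt (by fun_prop) (by fun_prop)
  have hST : {x : ℝ | min |x| |x + z| < |z| / 8} = S ∪ T := by
    ext x; simp [S, T]
  have hdisj : Disjoint S T := Set.disjoint_left.2 fun x (hx : |x| < _) (hx' : |x + z| < _) => by
    have h := abs_sub (x + z) x
    rw [add_sub_cancel_left] at h
    have := abs_nonneg x
    linarith
  obtain ⟨hSi, hSb⟩ := setIntegral_comp_le_of_le_abs_deriv hS (fun x _ => hPd x)
    (hinj S fun x hx y hy => by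
      obtain ⟨hx1, -⟩ := abs_mul_le_and_sq_le_of_abs_lt hx
      obtain ⟨hy1, -⟩ := abs_mul_le_and_sq_le_of_abs_lt hy
      rw [abs_le] at hx1 hy1
      apply ne_of_gt
      nlinarith [sq_nonneg (x + y), sq_nonneg x, sq_nonneg y]) hz2
    (fun x hx => by
      obtain ⟨hx1, -⟩ := abs_mul_le_and_sq_le_of_abs_lt hx
      rw [abs_le] at hx1
      refine le_trans ?_ (le_abs_self _)
      nlinarith [sq_nonneg x]) hg hg0 hmeas.aestronglyMeasurable
  obtain ⟨hTi, hTb⟩ := setIntegral_comp_le_of_le_abs_deriv hT (fun x _ => hPd x)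
    (hinj T fun x hx y hy => by
      obtain ⟨hx1, hx2⟩ := abs_mul_le_and_sq_le_of_abs_lt hx
      obtain ⟨hy1, hy2⟩ := abs_mul_le_and_sq_le_of_abs_lt hy
      rw [abs_le] at hx1 hy1
      apply ne_of_lt
      nlinarith [sq_nonneg (x - y)]) hz2
    (fun x hx => by
      obtain ⟨hx1, hx2⟩ := abs_mul_le_and_sq_le_of_abs_lt hx
      rw [abs_le] at hx1
      refine le_trans ?_ (neg_le_abs _)
      nlinarith) hg hg0 hmeas.aestronglyMeasurable
  rw [hST, setIntegral_union hdisj hT hSi hTi]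
  refine (add_le_add hSb hTb).trans ?_
  rw [← add_div]
  exact div_le_div_of_nonneg_right (by linarith) hz2.le
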